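/- The coverage checking algorithm terminates: the measure M(W), defined as the multiset of lexicographically ordered pairs (measure of goal φ, cardinality of its safe-variable set X) for (φ, X) ∈ W, strictly decreases with each iteration of the loop, where each iteration either removes an immediately covered pair, moves a pair with empty X to the counterexample set, replaces (φ, X) after successful splitting by finitely many pairs with strictly smaller goal measure, or replaces (φ, X) by (φ, X∖{x}) after a failed split. -/

import Mathlib

/-- Termination of the coverage checking algorithm: W is a multiset of pairs
(goal φ, finite set X of safe splitting variables); every loop iteration
either removes a pair (immediately covered goal, or counterexample with
X = ∅), replaces a pair by finitely many pairs whose goals have strictly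
smaller measure (successful splitting), or shrinks X (failed splitting).
Hence there is no infinite run. -/
theorem coverage_algorithm_terminates
    (Goal V : Type) [DecidableEq V]
    (μ : Goal → ℕ)                       -- measure of a goal
    (Step : Multiset (Goal × Finset V) → Multiset (Goal × Finset V) → Prop)
    (hStep : ∀ W W', Step W W' → ∃ (φ : Goal) (X : Finset V) (W₀ : Multiset (Goal × Finset V)),
        W = (φ, X) ::ₘ W₀ ∧
        (W' = W₀ ∨
         (∃ L : Multiset (Goal × Finset V), W' = L + W₀ ∧ ∀ q ∈ L, μ q.1 < μ φ) ∨
         (∃ x ∈ X, W' = (φ, X.erase x) ::ₘ W₀))) :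
    ∀ f : ℕ → Multiset (Goal × Finset V), ¬ (∀ n, Step (f n) (f (n + 1))) := by
  intro f hf
  let m : Goal × Finset V → ℕ ×ₗ ℕ := fun p => toLex (μ p.1, p.2.card)
  let r : Goal × Finset V → Goal × Finset V → Prop := InvImage (· < ·) m
  have hr : WellFounded r := InvImage.wf m wellFounded_lt
  have hc : WellFounded (Relation.CutExpand r) := hr.cutExpand
  have key : ∀ W W', Step W W' → Relation.CutExpand r W' W := by
    intro W W' h
    obtain ⟨φ, X, W₀, rfl, hs⟩ := hStep W W' h
    rcases hs with rfl | ⟨L, rfl, hL⟩ | ⟨x, hx, rfl⟩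
    · refine ⟨0, (φ, X), by simp, ?_⟩
      rw [add_zero, ← Multiset.singleton_add, add_comm]
    · refine ⟨L, (φ, X), fun q hq => ?_, ?_⟩
      · exact Prod.Lex.toLex_lt_toLex.2 (Or.inl (hL q hq))
      · rw [← Multiset.singleton_add]; abel
    · refine ⟨{(φ, X.erase x)}, (φ, X), fun q hq => ?_, ?_⟩
      · rw [Multiset.mem_singleton] at hq
        subst hq
        exact Prod.Lex.toLex_lt_toLex.2 (Or.inr ⟨rfl, Finset.card_erase_lt_of_mem hx⟩)
      · rw [← Multiset.singleton_add, ← Multiset.singleton_add]; abel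
  obtain ⟨_, ⟨n, rfl⟩, hn⟩ := hc.has_min (Set.range f) ⟨f 0, 0, rfl⟩
  exact hn (f (n + 1)) ⟨n + 1, rfl⟩ (key _ _ (hf n))
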